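/- arXiv:1302.7069 — 3 statements merged into one kernel-verified Lean document; each statement's English description precedes it below -/
import Mathlib

section
/- The index set FINL = {e : e codes a u.c.e. family that is TxtFin-learnable by some learner} is a Σ⁰₃ set, i.e., membership in FINL is definable by a Σ⁰₃ predicate. -/
/-- `Wset e` is the `e`-th computably enumerable set: the domain of the `e`-th
partial computable function in the standard numbering by codes. -/
def Wset (e : ℕ) : Set ℕ :=
  {x | ((Denumerable.ofNat Nat.Partrec.Code e).eval x).Dom}

/-- The `i`-th column `{x : ⟨i,x⟩ ∈ W_a}` of the c.e. set coded by `a`;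
the number `a` codes the u.c.e. family whose members are its columns. -/
def column (a i : ℕ) : Set ℕ := {x | Nat.pair i x ∈ Wset a}

/-- The initial segment of length `n` of an enumeration `f`. -/
def initSeg (f : ℕ → ℕ) (n : ℕ) : List ℕ := (List.range n).map f

/-- The `m`-th computable learner in the standard effective enumeration of all
partial computable functions from finite sequences to ℕ. -/
def learnerOfCode (m : ℕ) : List ℕ →. ℕ :=
  fun σ => (Denumerable.ofNat Nat.Partrec.Code m).eval (Encodable.encode σ)

/-- `M` TxtFin-identifies the enumeration `f` (here `Option.none` plays the
role of the symbol `?`). -/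
def TxtFinIdentifies (M : List ℕ →. Option ℕ) (f : ℕ → ℕ) : Prop :=
  ∃ n h, (∀ n' < n, M (initSeg f n') = Part.some Option.none) ∧
    M (initSeg f n) = Part.some (Option.some h) ∧ Wset h = Set.range f

/-- `M` TxtFin-learns the set `S`. -/
def TxtFinLearnsSet (M : List ℕ →. Option ℕ) (S : Set ℕ) : Prop :=
  ∀ f : ℕ → ℕ, Set.range f = S → TxtFinIdentifies M f

/-- `M` TxtEx-identifies the enumeration `f`. -/
def TxtExIdentifies (M : List ℕ →. ℕ) (f : ℕ → ℕ) : Prop :=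
  ∃ n, (∃ N, ∀ i ≥ N, M (initSeg f i) = Part.some n) ∧ Wset n = Set.range f

/-- `M` TxtEx-learns the set `S`. -/
def TxtExLearnsSet (M : List ℕ →. ℕ) (S : Set ℕ) : Prop :=
  ∀ f : ℕ → ℕ, Set.range f = S → TxtExIdentifies M f

/-- `M` TxtBC-identifies the enumeration `f`. -/
def TxtBCIdentifies (M : List ℕ →. ℕ) (f : ℕ → ℕ) : Prop :=
  ∃ N, ∀ i ≥ N, ∃ h, M (initSeg f i) = Part.some h ∧ Wset h = Set.range f

/-- `M` TxtBC-learns the set `S`. -/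
def TxtBCLearnsSet (M : List ℕ →. ℕ) (S : Set ℕ) : Prop :=
  ∀ f : ℕ → ℕ, Set.range f = S → TxtBCIdentifies M f

/-- `M` TxtEx*-identifies the enumeration `f`. -/
def TxtExStarIdentifies (M : List ℕ →. ℕ) (f : ℕ → ℕ) : Prop :=
  ∃ n, (∃ N, ∀ i ≥ N, M (initSeg f i) = Part.some n) ∧
    (symmDiff (Wset n) (Set.range f)).Finite

/-- `M` TxtEx*-learns the set `S`. -/
def TxtExStarLearnsSet (M : List ℕ →. ℕ) (S : Set ℕ) : Prop :=
  ∀ f : ℕ → ℕ, Set.range f = S → TxtExStarIdentifies M f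

/-- Indices of cofinite c.e. sets. -/
def COF : Set ℕ := {e | (Wset e)ᶜ.Finite}

/-- Indices of coinfinite c.e. sets. -/
def COINF : Set ℕ := {e | (Wset e)ᶜ.Infinite}

/-- `P` is Σ⁰₃: definable by `∃∀∃` over a computable relation. -/
def IsSigma3 (P : Set ℕ) : Prop :=
  ∃ R : ℕ → ℕ → ℕ → ℕ → Bool,
    Computable (fun p : ℕ × ℕ × ℕ × ℕ => R p.1 p.2.1 p.2.2.1 p.2.2.2) ∧
    ∀ e, e ∈ P ↔ ∃ x, ∀ y, ∃ z, R e x y z = true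

/-- `P` is Σ⁰₄: definable by `∃∀∃∀` over a computable relation. -/
def IsSigma4 (P : Set ℕ) : Prop :=
  ∃ R : ℕ → ℕ → ℕ → ℕ → ℕ → Bool,
    Computable (fun p : ℕ × ℕ × ℕ × ℕ × ℕ =>
      R p.1 p.2.1 p.2.2.1 p.2.2.2.1 p.2.2.2.2) ∧
    ∀ e, e ∈ P ↔ ∃ x, ∀ y, ∃ z, ∀ w, R e x y z w = true

/-- `P` is Σ⁰₅: definable by `∃∀∃∀∃` over a computable relation. -/
def IsSigma5 (P : Set ℕ) : Prop :=
  ∃ R : ℕ → ℕ → ℕ → ℕ → ℕ → ℕ → Bool,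
    Computable (fun p : ℕ × ℕ × ℕ × ℕ × ℕ × ℕ =>
      R p.1 p.2.1 p.2.2.1 p.2.2.2.1 p.2.2.2.2.1 p.2.2.2.2.2) ∧
    ∀ e, e ∈ P ↔ ∃ x, ∀ y, ∃ z, ∀ w, ∃ v, R e x y z w v = true

/-- `f : ℕ → ℕ` is Δ⁰₂: the pointwise limit of a computable function. -/
def IsDelta2Fun (f : ℕ → ℕ) : Prop :=
  ∃ g : ℕ → ℕ → ℕ, Computable₂ g ∧ ∀ x, ∃ s₀, ∀ s ≥ s₀, g s x = f x

/-- The index set of codes of TxtFin-learnable u.c.e. families. -/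
def FINL : Set ℕ :=
  {e | ∃ M : List ℕ →. Option ℕ, Partrec M ∧ ∀ i, TxtFinLearnsSet M (column e i)}

open Nat.Partrec (Code)
open Nat.Partrec.Code (evaln evaln_mono evaln_sound evaln_complete primrec_evaln)

/-- The number `x` is enumerated into `Wset e` within `t` steps. -/
def StageMem (t e x : ℕ) : Prop :=
  (evaln t (Denumerable.ofNat Code e) x).isSome = true

theorem mem_Wset_iff {e x : ℕ} : x ∈ Wset e ↔ ∃ t, StageMem t e x := by
  simp only [Wset, StageMem, Set.mem_ofPred_eq, Part.dom_iff_mem, evaln_complete,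
    Option.isSome_iff_exists, Option.mem_def]
  exact exists_comm

theorem StageMem.mono {s t e x : ℕ} (hst : s ≤ t) (h : StageMem s e x) : StageMem t e x := by
  obtain ⟨y, hy⟩ := Option.isSome_iff_exists.1 h
  exact Option.isSome_iff_exists.2 ⟨y, evaln_mono hst hy⟩

theorem exists_stage_of_forall_mem {e i : ℕ} {σ : List ℕ} (h : ∀ w ∈ σ, w ∈ column e i) :
    ∃ t, ∀ w ∈ σ, StageMem t e (Nat.pair i w) := by
  induction σ with
  | nil => exact ⟨0, by simp⟩
  | cons a σ ih =>
    obtain ⟨t, ht⟩ := ih fun w hw => h w (List.mem_cons_of_mem _ hw)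
    obtain ⟨s, hs⟩ := mem_Wset_iff.1 (h a List.mem_cons_self)
    refine ⟨max s t, fun w hw => ?_⟩
    rcases List.mem_cons.1 hw with rfl | hw
    · exact hs.mono (le_max_left _ _)
    · exact (ht w hw).mono (le_max_right _ _)

theorem primrec_evaln_ofNat :
    Primrec fun p : ℕ × ℕ × ℕ => evaln p.1 (Denumerable.ofNat Code p.2.1) p.2.2 :=
  primrec_evaln.comp <| Primrec.pair
    (Primrec.pair .fst ((Primrec.ofNat Code).comp (Primrec.fst.comp .snd)))
    (Primrec.snd.comp .snd)

theorem PrimrecPred.stageMem {α : Type*} [Primcodable α] {t e x : α → ℕ}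
    (ht : Primrec t) (he : Primrec e) (hx : Primrec x) :
    PrimrecPred fun a => StageMem (t a) (e a) (x a) :=
  Primrec.eq.comp
    (Primrec.option_isSome.comp (primrec_evaln_ofNat.comp (ht.pair (he.pair hx))))
    (Primrec.const true)

theorem PrimrecPred.forall_mem_stageMem {α : Type*} [Primcodable α] {t e i : α → ℕ}
    {σ : α → List ℕ} (hσ : Primrec σ) (ht : Primrec t) (he : Primrec e) (hi : Primrec i) :
    PrimrecPred fun a => ∀ w ∈ σ a, StageMem (t a) (e a) (Nat.pair (i a) w) := by
  have h : PrimrecRel fun (w : ℕ) (a : α) => StageMem (t a) (e a) (Nat.pair (i a) w) :=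
    PrimrecPred.stageMem (ht.comp .snd) (he.comp .snd)
      (Primrec₂.natPair.comp (hi.comp .snd) .fst)
  exact h.forall_mem_list.comp hσ .id

theorem PrimrecPred.imp {α : Type*} [Primcodable α] {p q : α → Prop}
    (hp : PrimrecPred p) (hq : PrimrecPred q) : PrimrecPred fun a => p a → q a :=
  (hp.not.or hq).of_eq fun _ => imp_iff_not_or.symm

/-- The inner quantifiers in the definition of `Σ⁰₃` may range over denumerable types. -/
theorem IsSigma3.of_primrecPred {Y Z : Type} [Denumerable Y] [Denumerable Z] {P : Set ℕ}
    {Q : ℕ × ℕ × Y × Z → Prop} (hQ : PrimrecPred Q)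
    (hP : ∀ e, e ∈ P ↔ ∃ x, ∀ y, ∃ z, Q (e, x, y, z)) : IsSigma3 P := by
  classical
  refine ⟨fun e x y z => decide (Q (e, x, Denumerable.ofNat Y y, Denumerable.ofNat Z z)),
    ?_, fun e => ?_⟩
  · have h : Primrec fun p : ℕ × ℕ × ℕ × ℕ =>
        ((p.1, p.2.1, Denumerable.ofNat Y p.2.2.1, Denumerable.ofNat Z p.2.2.2) :
          ℕ × ℕ × Y × Z) :=
      Primrec.pair .fst <| Primrec.pair (Primrec.fst.comp .snd) <| Primrec.pair
        ((Primrec.ofNat Y).comp (Primrec.fst.comp (Primrec.snd.comp .snd)))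
        ((Primrec.ofNat Z).comp (Primrec.snd.comp (Primrec.snd.comp .snd)))
    exact (hQ.comp h).decide.to_comp
  · simp only [hP, decide_eq_true_eq]
    refine exists_congr fun x => ⟨fun h y => ?_, fun h y => ?_⟩
    · obtain ⟨z, hz⟩ := h (Denumerable.ofNat Y y)
      exact ⟨Encodable.encode z, by simpa using hz⟩
    · obtain ⟨z, hz⟩ := h (Encodable.encode y)
      exact ⟨_, by simpa using hz⟩

/-- `m` codes a partial computable map assigning correct indices to some finite sequences: every
nonempty column of `e` contains a sequence in the domain of the map, and the index assigned to any
sequence contained in the column is an index of that column. -/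
def IsTellTaleMap (e m : ℕ) : Prop :=
  ∀ i, (column e i).Nonempty →
    (∃ σ : List ℕ, (∀ w ∈ σ, w ∈ column e i) ∧ (learnerOfCode m σ).Dom) ∧
    ∀ σ h, (∀ w ∈ σ, w ∈ column e i) → h ∈ learnerOfCode m σ → Wset h = column e i

theorem exists_learnerOfCode_eq {M : List ℕ →. ℕ} (hM : Partrec M) :
    ∃ m, learnerOfCode m = M := by
  have h : Nat.Partrec fun n => Part.bind (Encodable.decode (α := List ℕ) n) fun σ =>
      (M σ).map Encodable.encode := hM
  obtain ⟨c, hc⟩ := Code.exists_code.1 h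
  refine ⟨Encodable.encode c, funext fun σ => ?_⟩
  simp only [learnerOfCode, Denumerable.ofNat_encode, hc]
  simp only [Encodable.encodek, Part.coe_some, Part.bind_some]
  exact Part.map_id' (fun _ => rfl) _

/-- Run `M` on the initial segments of the given sequence and return the first hypothesis. -/
def firstHypothesis (M : List ℕ →. Option ℕ) (σ : List ℕ) : Part ℕ :=
  (Nat.rfind fun k => (M (σ.take k)).map Option.isSome).bind fun k =>
    (M (σ.take k)).map fun o => o.getD 0

theorem partrec_firstHypothesis {M : List ℕ →. Option ℕ} (hM : Partrec M) :
    Partrec (firstHypothesis M) := by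
  have htake : Partrec fun p : List ℕ × ℕ => M (p.1.take p.2) :=
    hM.comp (Primrec.list_take.comp .snd .fst).to_comp
  refine Partrec.bind (Partrec.rfind ?_) ?_
  · exact htake.map (Primrec.option_isSome.comp .snd).to_comp.to₂
  · exact htake.map (Primrec.option_getD.comp .snd (.const 0)).to_comp.to₂

theorem mem_firstHypothesis {M : List ℕ →. Option ℕ} {σ : List ℕ} {h : ℕ} :
    h ∈ firstHypothesis M σ ↔ ∃ k, M (σ.take k) = Part.some (some h) ∧
      ∀ j < k, M (σ.take j) = Part.some none := by
  rw [firstHypothesis, Part.mem_bind_iff]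
  refine exists_congr fun k => ⟨?_, ?_⟩
  · rintro ⟨hk, hh⟩
    obtain ⟨hk, hlt⟩ := Nat.mem_rfind.1 hk
    obtain ⟨o, ho, ho'⟩ := (Part.mem_map_iff _).1 hk
    obtain ⟨o', ho'', rfl⟩ := (Part.mem_map_iff _).1 hh
    obtain rfl := Part.mem_unique ho ho''
    obtain ⟨a, rfl⟩ := Option.isSome_iff_exists.1 ho'
    refine ⟨Part.eq_some_iff.2 ho, fun j hj => ?_⟩
    obtain ⟨o, h1, h2⟩ := (Part.mem_map_iff _).1 (hlt hj)
    cases o with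
    | none => exact Part.eq_some_iff.2 h1
    | some b => simp at h2
  · rintro ⟨h1, h2⟩
    refine ⟨Nat.mem_rfind.2 ⟨?_, fun {j} hj => ?_⟩, ?_⟩
    · simp [h1]
    · simp [h2 j hj]
    · simp [h1]

theorem length_initSeg (f : ℕ → ℕ) (n : ℕ) : (initSeg f n).length = n := by simp [initSeg]

theorem mem_initSeg {f : ℕ → ℕ} {n w : ℕ} : w ∈ initSeg f n ↔ ∃ j < n, f j = w := by
  simp [initSeg]

theorem take_initSeg (f : ℕ → ℕ) {k n : ℕ} (h : k ≤ n) :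
    (initSeg f n).take k = initSeg f k := by
  simp [initSeg, ← List.map_take, List.take_range, h]

/-- Every sequence contained in a nonempty set extends to an enumeration of the set. -/
theorem exists_range_eq_initSeg_eq {S : Set ℕ} (hS : S.Nonempty) {σ : List ℕ}
    (hσ : ∀ w ∈ σ, w ∈ S) : ∃ f : ℕ → ℕ, Set.range f = S ∧ initSeg f σ.length = σ := by
  obtain ⟨g, rfl⟩ := (Set.to_countable S).exists_eq_range hS
  refine ⟨fun n => if h : n < σ.length then σ[n] else g (n - σ.length), ?_, ?_⟩
  · ext x
    constructor
    · rintro ⟨n, rfl⟩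
      dsimp only
      split_ifs with h
      · exact hσ _ (List.getElem_mem h)
      · exact ⟨_, rfl⟩
    · rintro ⟨n, rfl⟩
      exact ⟨n + σ.length, by simp⟩
  · refine List.ext_getElem (length_initSeg _ _) fun n h1 h2 => ?_
    simp [initSeg, h2]

theorem exists_isTellTaleMap {e : ℕ} {M : List ℕ →. Option ℕ} (hM : Partrec M)
    (hlearn : ∀ i, TxtFinLearnsSet M (column e i)) : ∃ m, IsTellTaleMap e m := by
  obtain ⟨m, hm⟩ := exists_learnerOfCode_eq (partrec_firstHypothesis hM)
  refine ⟨m, fun i hne => ?_⟩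
  rw [hm]
  constructor
  · obtain ⟨f, hf, -⟩ := exists_range_eq_initSeg_eq hne (σ := []) (by simp)
    obtain ⟨n, h, hlt, hn, -⟩ := hlearn i f hf
    refine ⟨initSeg f n, fun w hw => ?_, Part.dom_iff_mem.2 ⟨h, mem_firstHypothesis.2 ⟨n, ?_, ?_⟩⟩⟩
    · obtain ⟨j, -, rfl⟩ := mem_initSeg.1 hw
      exact hf ▸ Set.mem_range_self j
    · rwa [take_initSeg f le_rfl]
    · intro j hj
      rw [take_initSeg f hj.le]
      exact hlt j hj
  · intro σ h hσ hh
    obtain ⟨k, hk, hlt⟩ := mem_firstHypothesis.1 hh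
    obtain ⟨f, hf, hfσ⟩ := exists_range_eq_initSeg_eq hne hσ
    obtain ⟨n, h', hlt', hn, hW⟩ := hlearn i f hf
    have hkσ : k ≤ σ.length := by
      by_contra! hlen
      have := hlt _ hlen
      rw [List.take_length, ← List.take_of_length_le hlen.le, hk] at this
      simp at this
    have htake : ∀ j ≤ k, σ.take j = initSeg f j := fun j hj => by
      conv_lhs => rw [← hfσ]
      exact take_initSeg f (hj.trans hkσ)
    rw [htake k le_rfl] at hk
    obtain rfl : n = k := by
      rcases lt_trichotomy n k with h | h | h
      · have := hlt n h
        rw [htake n h.le, hn] at this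
        simp at this
      · exact h
      · have := hlt' k h
        rw [hk] at this
        simp at this
    rw [hn] at hk
    obtain rfl : h' = h := by simpa using hk
    rw [hW, hf]

/-- Look for a sequence coded below the length of `σ` and contained in `σ` to which the map coded
by `m` assigns an index within that many steps, and return the first such index. -/
def tellTaleLearner (m : ℕ) (σ : List ℕ) : Option ℕ :=
  ((List.range σ.length).filterMap fun k =>
    if ∀ w ∈ Denumerable.ofNat (List ℕ) k, w ∈ σ then
      evaln σ.length (Denumerable.ofNat Code m) k else none).head?

theorem primrec_tellTaleLearner (m : ℕ) : Primrec (tellTaleLearner m) := by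
  have hmem : PrimrecRel fun (w : ℕ) (σ : List ℕ) => w ∈ σ := by
    have h : PrimrecRel fun (w' w : ℕ) => w' = w := Primrec.eq
    exact (h.exists_mem_list.comp Primrec.snd Primrec.fst).of_eq fun p => by simp
  refine Primrec.list_head?.comp
    (Primrec.listFilterMap (Primrec.list_range.comp .list_length) (Primrec.ite ?_ ?_ (.const none)))
  · exact hmem.forall_mem_list.comp ((Primrec.ofNat (List ℕ)).comp .snd) .fst
  · exact primrec_evaln_ofNat.comp
      ((Primrec.list_length.comp .fst).pair ((Primrec.const m).pair .snd))

theorem exists_of_tellTaleLearner_eq_some {m h : ℕ} {σ : List ℕ}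
    (hh : tellTaleLearner m σ = some h) :
    ∃ τ : List ℕ, (∀ w ∈ τ, w ∈ σ) ∧ h ∈ learnerOfCode m τ := by
  have := List.mem_of_head? hh
  obtain ⟨k, -, hk⟩ := List.mem_filterMap.1 this
  split_ifs at hk with hsub
  refine ⟨_, hsub, ?_⟩
  simpa [learnerOfCode] using evaln_sound hk

theorem tellTaleLearner_isSome {m h t : ℕ} {σ τ : List ℕ} (hsub : ∀ w ∈ τ, w ∈ σ)
    (hh : h ∈ evaln t (Denumerable.ofNat Code m) (Encodable.encode τ))
    (ht : t ≤ σ.length) : (tellTaleLearner m σ).isSome = true := by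
  have hmem : h ∈ (List.range σ.length).filterMap fun k =>
      if ∀ w ∈ Denumerable.ofNat (List ℕ) k, w ∈ σ then
        evaln σ.length (Denumerable.ofNat Code m) k else none := by
    refine List.mem_filterMap.2 ⟨Encodable.encode τ, ?_, ?_⟩
    · exact List.mem_range.2 ((Nat.Partrec.Code.evaln_bound hh).trans_le ht)
    · rw [Denumerable.ofNat_encode, if_pos hsub]
      exact evaln_mono ht hh
  rw [tellTaleLearner, List.isSome_head?]
  simpa using List.ne_nil_of_mem hmem

theorem exists_forall_mem_initSeg {f : ℕ → ℕ} {τ : List ℕ} (hτ : ∀ w ∈ τ, w ∈ Set.range f) :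
    ∃ N, ∀ n ≥ N, ∀ w ∈ τ, w ∈ initSeg f n := by
  induction τ with
  | nil => exact ⟨0, by simp⟩
  | cons a τ ih =>
    obtain ⟨N, hN⟩ := ih fun w hw => hτ w (List.mem_cons_of_mem _ hw)
    obtain ⟨j, rfl⟩ := hτ a List.mem_cons_self
    refine ⟨max N (j + 1), fun n hn w hw => ?_⟩
    rcases List.mem_cons.1 hw with rfl | hw
    · exact mem_initSeg.2 ⟨j, (le_max_right _ _).trans hn, rfl⟩
    · exact hN n ((le_max_left _ _).trans hn) w hw

theorem IsTellTaleMap.learns {e m : ℕ} (hm : IsTellTaleMap e m) (i : ℕ) :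
    TxtFinLearnsSet (fun σ => Part.some (tellTaleLearner m σ)) (column e i) := by
  intro f hf
  obtain ⟨⟨τ, hτ, hdom⟩, hcorrect⟩ := hm i (hf ▸ Set.range_nonempty f)
  obtain ⟨h, hh⟩ := Part.dom_iff_mem.1 hdom
  obtain ⟨t, ht⟩ := evaln_complete.1 hh
  obtain ⟨N, hN⟩ := exists_forall_mem_initSeg (f := f) (τ := τ) (by rwa [hf])
  have hex : ∃ n, (tellTaleLearner m (initSeg f n)).isSome = true :=
    ⟨max N t, tellTaleLearner_isSome (hN _ (le_max_left _ _)) ht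
      (by rw [length_initSeg]; exact le_max_right _ _)⟩
  obtain ⟨h', hh'⟩ := Option.isSome_iff_exists.1 (Nat.find_spec hex)
  refine ⟨Nat.find hex, h', fun n hn => ?_, congrArg Part.some hh', ?_⟩
  · exact congrArg Part.some (by simpa using Nat.find_min hex hn)
  · obtain ⟨ρ, hρ, hmem⟩ := exists_of_tellTaleLearner_eq_some hh'
    rw [hf]
    refine hcorrect ρ h' (fun w hw => ?_) hmem
    obtain ⟨j, -, rfl⟩ := mem_initSeg.1 (hρ w hw)
    exact hf ▸ Set.mem_range_self j

theorem mem_FINL_iff {e : ℕ} : e ∈ FINL ↔ ∃ m, IsTellTaleMap e m := by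
  refine ⟨fun ⟨M, hM, h⟩ => exists_isTellTaleMap hM h, fun ⟨m, hm⟩ => ⟨_, ?_, hm.learns⟩⟩
  exact (primrec_tellTaleLearner m).to_comp

/-- The matrix of the `∀∃` form of `IsTellTaleMap e m`. The universally quantified data are a
column `i`, an element `v` of it, a sequence `σ` with assigned index `h`, a number `u` and a number
of steps `s`; the existentially quantified data are a sequence `τ` and four numbers of steps. -/
def TellTaleMatrix (e m i v : ℕ) (σ : List ℕ) (h u s : ℕ) (τ : List ℕ) (t₁ t₂ t₃ t₄ : ℕ) : Prop :=
  StageMem s e (Nat.pair i v) →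
    ((∀ w ∈ τ, StageMem t₁ e (Nat.pair i w)) ∧ StageMem t₂ m (Encodable.encode τ)) ∧
    ((∀ w ∈ σ, StageMem s e (Nat.pair i w)) →
      evaln s (Denumerable.ofNat Code m) (Encodable.encode σ) = some h →
      (StageMem s h u → StageMem t₃ e (Nat.pair i u)) ∧
      (StageMem s e (Nat.pair i u) → StageMem t₄ h u))

theorem isTellTaleMap_iff {e m : ℕ} :
    IsTellTaleMap e m ↔ ∀ i v σ h u s, ∃ τ t₁ t₂ t₃ t₄,
      TellTaleMatrix e m i v σ h u s τ t₁ t₂ t₃ t₄ := by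
  constructor
  · intro hm i v σ h u s
    by_cases hv : StageMem s e (Nat.pair i v)
    swap
    · exact ⟨[], 0, 0, 0, 0, fun h => (hv h).elim⟩
    obtain ⟨⟨τ, hτ, hdom⟩, hcorrect⟩ := hm i ⟨v, mem_Wset_iff.2 ⟨s, hv⟩⟩
    obtain ⟨t₁, ht₁⟩ := exists_stage_of_forall_mem hτ
    obtain ⟨t₂, ht₂⟩ := mem_Wset_iff.1 (show Encodable.encode τ ∈ Wset m from hdom)
    by_cases hσ : (∀ w ∈ σ, StageMem s e (Nat.pair i w)) ∧
      evaln s (Denumerable.ofNat Code m) (Encodable.encode σ) = some h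
    swap
    · exact ⟨τ, t₁, t₂, 0, 0, fun _ => ⟨⟨ht₁, ht₂⟩, fun h1 h2 => (hσ ⟨h1, h2⟩).elim⟩⟩
    have hW : Wset h = column e i :=
      hcorrect σ h (fun w hw => mem_Wset_iff.2 ⟨s, hσ.1 w hw⟩) (evaln_sound hσ.2)
    by_cases hu : u ∈ Wset h
    · obtain ⟨t₄, ht₄⟩ := mem_Wset_iff.1 hu
      rw [hW] at hu
      obtain ⟨t₃, ht₃⟩ := mem_Wset_iff.1 hu
      exact ⟨τ, t₁, t₂, t₃, t₄, fun _ => ⟨⟨ht₁, ht₂⟩, fun _ _ => ⟨fun _ => ht₃, fun _ => ht₄⟩⟩⟩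
    · refine ⟨τ, t₁, t₂, 0, 0, fun _ => ⟨⟨ht₁, ht₂⟩, fun _ _ =>
        ⟨fun h1 => (hu (mem_Wset_iff.2 ⟨s, h1⟩)).elim, fun h1 => (hu ?_).elim⟩⟩⟩
      rw [hW]
      exact mem_Wset_iff.2 ⟨s, h1⟩
  · rintro H i ⟨v, hv⟩
    obtain ⟨s₀, hs₀⟩ := mem_Wset_iff.1 hv
    constructor
    · obtain ⟨τ, t₁, t₂, _, _, hmat⟩ := H i v [] 0 0 s₀
      obtain ⟨⟨h1, h2⟩, -⟩ := hmat hs₀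
      exact ⟨τ, fun w hw => mem_Wset_iff.2 ⟨t₁, h1 w hw⟩, mem_Wset_iff.2 ⟨t₂, h2⟩⟩
    · intro σ h hσ hh
      obtain ⟨s₁, hs₁⟩ := exists_stage_of_forall_mem hσ
      obtain ⟨s₂, hs₂⟩ := evaln_complete.1 hh
      have key : ∀ u s, s₀ ≤ s → s₁ ≤ s → s₂ ≤ s → ∃ t₃ t₄,
          (StageMem s h u → StageMem t₃ e (Nat.pair i u)) ∧
          (StageMem s e (Nat.pair i u) → StageMem t₄ h u) := by
        intro u s h0 h1 h2
        obtain ⟨τ, _, _, t₃, t₄, hmat⟩ := H i v σ h u s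
        exact ⟨t₃, t₄, (hmat (hs₀.mono h0)).2 (fun w hw => (hs₁ w hw).mono h1)
          (evaln_mono h2 hs₂)⟩
      ext u
      constructor <;> intro hu <;> obtain ⟨s₃, hs₃⟩ := mem_Wset_iff.1 hu <;>
        obtain ⟨t₃, t₄, h3, h4⟩ := key u (s₀ + s₁ + s₂ + s₃) (by omega) (by omega) (by omega)
      · exact mem_Wset_iff.2 ⟨t₃, h3 (hs₃.mono (by omega))⟩
      · exact mem_Wset_iff.2 ⟨t₄, h4 (hs₃.mono (by omega))⟩

theorem PrimrecPred.tellTaleMatrix {α : Type*} [Primcodable α]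
    {e m i v h u s t₁ t₂ t₃ t₄ : α → ℕ} {σ τ : α → List ℕ}
    (he : Primrec e) (hm : Primrec m) (hi : Primrec i) (hv : Primrec v) (hσ : Primrec σ)
    (hh : Primrec h) (hu : Primrec u) (hs : Primrec s) (hτ : Primrec τ) (h₁ : Primrec t₁)
    (h₂ : Primrec t₂) (h₃ : Primrec t₃) (h₄ : Primrec t₄) :
    PrimrecPred fun a => TellTaleMatrix (e a) (m a) (i a) (v a) (σ a) (h a) (u a) (s a) (τ a)
      (t₁ a) (t₂ a) (t₃ a) (t₄ a) := by
  have hiu := Primrec₂.natPair.comp hi hu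
  refine (stageMem hs he (Primrec₂.natPair.comp hi hv)).imp (.and (.and ?_ ?_)
    (.imp ?_ (.imp ?_ (.and (.imp ?_ ?_) (.imp ?_ ?_)))))
  · exact forall_mem_stageMem hτ h₁ he hi
  · exact stageMem h₂ hm (Primrec.encode.comp hτ)
  · exact forall_mem_stageMem hσ hs he hi
  · exact Primrec.eq.comp
      (primrec_evaln_ofNat.comp (hs.pair (hm.pair (Primrec.encode.comp hσ))))
      (Primrec.option_some.comp hh)
  · exact stageMem hs hh hu
  · exact stageMem h₃ he hiu
  · exact stageMem hs he hiu
  · exact stageMem h₄ hh hu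

/-- FINL is a Σ⁰₃ set. -/
theorem FINL_isSigma3 : IsSigma3 FINL := by
  have e₁ : Primrec fun p : ℕ × ℕ × (ℕ × ℕ × List ℕ × ℕ × ℕ × ℕ) × (List ℕ × ℕ × ℕ × ℕ × ℕ) =>
      p.2.2.1 := Primrec.fst.comp (Primrec.snd.comp .snd)
  have e₂ : Primrec fun p : ℕ × ℕ × (ℕ × ℕ × List ℕ × ℕ × ℕ × ℕ) × (List ℕ × ℕ × ℕ × ℕ × ℕ) =>
      p.2.2.2 := Primrec.snd.comp (Primrec.snd.comp .snd)
  have y₁ := Primrec.snd.comp e₁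
  have y₂ := Primrec.snd.comp y₁
  have y₃ := Primrec.snd.comp y₂
  have y₄ := Primrec.snd.comp y₃
  have z₁ := Primrec.snd.comp e₂
  have z₂ := Primrec.snd.comp z₁
  have z₃ := Primrec.snd.comp z₂
  refine IsSigma3.of_primrecPred (PrimrecPred.tellTaleMatrix Primrec.fst
    (Primrec.fst.comp .snd) (Primrec.fst.comp e₁) (Primrec.fst.comp y₁) (Primrec.fst.comp y₂)
    (Primrec.fst.comp y₃) (Primrec.fst.comp y₄) (Primrec.snd.comp y₄) (Primrec.fst.comp e₂)
    (Primrec.fst.comp z₁) (Primrec.fst.comp z₂) (Primrec.fst.comp z₃) (Primrec.snd.comp z₃))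
    fun e => ?_
  simp only [mem_FINL_iff, isTellTaleMap_iff, Prod.forall, Prod.exists]
end

section
/- The index set FINL = {e : e codes a u.c.e. family that is TxtFin-learnable by some learner} is Σ⁰₃-hard: every Σ⁰₃ set many-one reduces to FINL via a computable function. -/
open Nat.Partrec (Code)

/-- Projecting a computable relation yields a uniformly c.e. sequence of sets. -/
theorem exists_computable_index {β : Type*} [Primcodable β] (D : ℕ → ℕ → β → Bool)
    (hD : Computable fun p : ℕ × ℕ × β => D p.1 p.2.1 p.2.2) :
    ∃ g : ℕ → ℕ, Computable g ∧ ∀ e x, x ∈ Wset (g e) ↔ ∃ w, D e x w = true := by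
  let q : ℕ → ℕ → Bool := fun p n =>
    Option.casesOn (Encodable.decode (α := β) n) false (D p.unpair.1 p.unpair.2)
  have hq : Computable₂ q := by
    refine Computable.option_casesOn (Computable.decode.comp Computable.snd)
      (Computable.const false) ?_
    have hu : Computable fun a : (ℕ × ℕ) × β => a.1.1.unpair :=
      Primrec.unpair.to_comp.comp (Computable.fst.comp Computable.fst)
    have hargs := (Computable.fst.comp hu).pair ((Computable.snd.comp hu).pair Computable.snd)
    have h := hD.comp hargs
    exact h
  have hF : Partrec fun p : ℕ => Nat.rfind fun n => Part.some (q p n) :=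
    Partrec.rfind hq.partrec₂
  obtain ⟨c, hc⟩ := Code.exists_code.1 (Partrec.nat_iff.1 hF)
  refine ⟨fun e => Encodable.encode (c.curry e), Computable.encode.comp
    (Code.primrec₂_curry.to_comp.comp (Computable.const c) Computable.id), fun e x => ?_⟩
  simp only [Wset, Set.mem_ofPred_eq, Denumerable.ofNat_encode, Code.eval_curry, hc]
  refine Nat.rfind_dom.trans ?_
  constructor
  · rintro ⟨n, hn, -⟩
    simp only [q, Part.mem_some_iff, Nat.unpair_pair] at hn
    cases h : Encodable.decode (α := β) n with
    | none => simp [h] at hn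
    | some w => exact ⟨w, by simpa [h] using hn.symm⟩
  · rintro ⟨w, hw⟩
    exact ⟨Encodable.encode w, by simp [q, hw], fun _ => trivial⟩

theorem exists_computable_column_index (a : ℕ) :
    ∃ c : ℕ → ℕ, Computable c ∧ ∀ i, Wset (c i) = column a i := by
  refine ⟨fun i => Encodable.encode ((Denumerable.ofNat Code a).curry i), Computable.encode.comp
    (Code.primrec₂_curry.to_comp.comp (Computable.const _) Computable.id), fun i => ?_⟩
  ext x
  simp [Wset, column, Code.eval_curry]

theorem initSeg_succ (f : ℕ → ℕ) (n : ℕ) : initSeg f (n + 1) = initSeg f n ++ [f n] := by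
  simp [initSeg, List.range_succ]

theorem initSeg_congr {f g : ℕ → ℕ} {n : ℕ} (h : ∀ i < n, f i = g i) :
    initSeg f n = initSeg g n :=
  List.map_congr_left fun i hi => h i (List.mem_range.1 hi)

/-- `A` recognises `S`: any value it gives to an element of `S` is an index of `S`, and some
element of `S` is given a value. -/
def Recognises (A : ℕ → Option ℕ) (S : Set ℕ) : Prop :=
  (∀ x ∈ S, ∀ h, A x = some h → Wset h = S) ∧ ∃ x ∈ S, A x ≠ none

theorem mem_FINL_of_recognises {a : ℕ} {A : ℕ → Option ℕ} (hA : Computable A)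
    (h : ∀ i, Recognises A (column a i)) : a ∈ FINL := by
  let M : List ℕ → Option ℕ := fun σ => σ.reverse.head?.bind A
  have hM : Computable M :=
    Computable.option_bind
      ((Primrec.list_head?.comp Primrec.list_reverse).to_comp) (hA.comp Computable.snd)
  have hMs : ∀ f n, M (initSeg f (n + 1)) = A (f n) := fun f n => by
    simp [M, initSeg_succ]
  refine ⟨fun σ => Part.some (M σ), hM.partrec, fun i f hf => ?_⟩
  obtain ⟨hi, x, hx, hAx⟩ := h i
  rw [← hf] at hx
  obtain ⟨n₀, rfl⟩ := hx
  have hex : ∃ n, A (f n) ≠ none := ⟨n₀, hAx⟩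
  obtain ⟨e, he⟩ := Option.ne_none_iff_exists'.1 (Nat.find_spec hex)
  refine ⟨Nat.find hex + 1, e, fun n' hn' => ?_, ?_, ?_⟩
  · cases n' with
    | zero => simp [M, initSeg]
    | succ k =>
      have := Nat.find_min hex (Nat.lt_of_succ_lt_succ hn')
      simp only [hMs]
      rw [not_not.1 this]
  · simp only [hMs, he]
  · rw [hf]
    exact hi _ (hf ▸ Set.mem_range_self _) _ he

theorem computable_of_eventually_none {G : ℕ → Option ℕ} {N : ℕ} (h : ∀ x ≥ N, G x = none) :
    Computable G := by
  have : Primrec fun x => (((List.range N).map G)[x]?).bind id :=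
    Primrec.option_bind (Primrec.list_getElem?.comp (Primrec.const _) Primrec.id)
      Primrec.snd
  refine (this.of_eq fun x => ?_).to_comp
  by_cases hx : x < N
  · simp [hx]
  · simp [h x (not_lt.1 hx), hx]

/-- The text `0, 1, …, 3k, 3k, 3k, …` inside the `m`-th column. -/
def blockText (m k : ℕ) : ℕ → ℕ := fun i => Nat.pair m (min i (3 * k))

/-- The `m`-th partial computable learner makes a conjecture on `blockText m k`. -/
def Conjectures (m k : ℕ) : Prop :=
  ∃ n v, v + 1 ∈ (Denumerable.ofNat Code m).eval (Encodable.encode (initSeg (blockText m k) n))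

/-- The members of the diagonalising family: each `k` satisfying `T m` puts the points up to `3k`
into both sets with first index `m`, and these are separated just above `3k` once the `m`-th
learner has made a conjecture on the common part. -/
def diagSet (T : ℕ → ℕ → Prop) (m j : ℕ) : Set ℕ :=
  {x | x.unpair.1 = m ∧ ∃ k, T m k ∧
    (x.unpair.2 ≤ 3 * k ∨ x.unpair.2 = 3 * k + 1 + j % 2 ∧ Conjectures m k)}

theorem diagSet_mod (T : ℕ → ℕ → Prop) (m j : ℕ) : diagSet T m (j % 2) = diagSet T m j := by
  simp [diagSet]

theorem mem_diagSet_of_max {T : ℕ → ℕ → Prop} {m k : ℕ} (hk : T m k)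
    (hmax : ∀ k', T m k' → k' ≤ k) {j y : ℕ} :
    Nat.pair m y ∈ diagSet T m j ↔ y ≤ 3 * k ∨ y = 3 * k + 1 + j % 2 ∧ Conjectures m k := by
  simp only [diagSet, Set.mem_ofPred_eq, Nat.unpair_pair, true_and]
  constructor
  · rintro ⟨k', hk', h⟩
    have hle := hmax k' hk'
    rcases hle.eq_or_lt with rfl | hlt
    · exact h
    · left
      have := Nat.mod_lt j (by norm_num : 2 > 0)
      rcases h with h | ⟨h, -⟩ <;> omega
  · exact fun h => ⟨k, hk, h⟩

theorem diagSet_of_forall {T : ℕ → ℕ → Prop} {m : ℕ} (h : ∀ k, T m k) (j : ℕ) :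
    diagSet T m j = {x | x.unpair.1 = m} := by
  ext x
  simp only [diagSet, Set.mem_ofPred_eq, and_iff_left_iff_imp]
  exact fun _ => ⟨x.unpair.2, h _, Or.inl (by omega)⟩

theorem pair_zero_mem_diagSet {T : ℕ → ℕ → Prop} {m : ℕ} (h : T m 0) (j : ℕ) :
    Nat.pair m 0 ∈ diagSet T m j := by
  simp only [diagSet, Set.mem_ofPred_eq, Nat.unpair_pair, true_and]
  exact ⟨0, h, Or.inl (by omega)⟩

theorem exists_max_of_not_forall {p : ℕ → Prop} (h0 : p 0) (hanti : ∀ k k', k ≤ k' → p k' → p k)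
    (h : ¬ ∀ k, p k) : ∃ k, p k ∧ ∀ k', p k' → k' ≤ k := by
  classical
  push Not at h
  obtain ⟨N, hN⟩ := h
  have hb : ∀ k', p k' → k' ≤ N := fun k' hk' =>
    not_lt.1 fun hlt => hN (hanti _ _ hlt.le hk')
  exact ⟨Nat.findGreatest p N, Nat.findGreatest_spec (Nat.zero_le N) h0,
    fun k' hk' => Nat.le_findGreatest (hb k' hk') hk'⟩

/-- Each pair of sets with the same first index is recognised by a finite table. -/
theorem exists_finite_recogniser {T : ℕ → ℕ → Prop} {m : ℕ} (h0 : T m 0)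
    (hanti : ∀ k k', k ≤ k' → T m k' → T m k) (hce : ∀ j, ∃ h, Wset h = diagSet T m j) :
    ∃ (G : ℕ → Option ℕ) (N : ℕ), (∀ x ≥ N, G x = none) ∧
      ∀ j, Recognises G (diagSet T m j) := by
  choose c hc using hce
  by_cases hall : ∀ i j, diagSet T m i = diagSet T m j
  · refine ⟨fun x => if x = Nat.pair m 0 then some (c 0) else none, Nat.pair m 0 + 1,
      fun x hx => if_neg (by omega), fun j => ⟨fun x _ h hx => ?_, Nat.pair m 0,
        pair_zero_mem_diagSet h0 j, by simp⟩⟩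
    obtain ⟨-, hh⟩ := Option.ite_none_right_eq_some.1 hx
    rw [← Option.some.inj hh, hc, hall]
  · have hT : ¬ ∀ k, T m k := fun h => hall fun i j => by
      rw [diagSet_of_forall h, diagSet_of_forall h]
    obtain ⟨k, hk, hmax⟩ := exists_max_of_not_forall h0 hanti hT
    have hconj : Conjectures m k := by
      by_contra hn
      refine hall fun i j => Set.ext fun x => ?_
      by_cases hx : x.unpair.1 = m
      · rw [← Nat.pair_unpair x, hx, mem_diagSet_of_max hk hmax, mem_diagSet_of_max hk hmax]
        simp [hn]
      · simp [diagSet, hx]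
    have hinj : ∀ y z, Nat.pair m y = Nat.pair m z ↔ y = z := fun y z => by
      simp [Nat.pair_eq_pair]
    refine ⟨fun x => if x = Nat.pair m (3 * k + 1) then some (c 0) else
        if x = Nat.pair m (3 * k + 2) then some (c 1) else none,
      Nat.pair m (3 * k + 1) + Nat.pair m (3 * k + 2) + 1,
      fun x hx => (if_neg (by omega)).trans (if_neg (by omega)), fun j => ⟨fun x hxS h hx => ?_,
        Nat.pair m (3 * k + 1 + j % 2), (mem_diagSet_of_max hk hmax).2 (Or.inr ⟨rfl, hconj⟩), ?_⟩⟩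
    · have hj := Nat.mod_two_eq_zero_or_one j
      dsimp only at hx
      split_ifs at hx with h1 h2
      · subst h1
        rw [mem_diagSet_of_max hk hmax] at hxS
        have : j % 2 = 0 := by rcases hxS with h | ⟨h, -⟩ <;> omega
        rw [← Option.some.inj hx, hc, ← diagSet_mod T m j, this]
      · subst h2
        rw [mem_diagSet_of_max hk hmax] at hxS
        have : j % 2 = 1 := by rcases hxS with h | ⟨h, -⟩ <;> omega
        rw [← Option.some.inj hx, hc, ← diagSet_mod T m j, this]
    · rcases Nat.mod_two_eq_zero_or_one j with h | h <;> simp [h, hinj]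

theorem mem_FINL_of_eventually_forall {T : ℕ → ℕ → Prop} {a m₀ : ℕ}
    (hcol : ∀ i, column a i = diagSet T i.unpair.1 i.unpair.2) (h0 : ∀ m, T m 0)
    (hanti : ∀ m k k', k ≤ k' → T m k' → T m k) (hT : ∀ m ≥ m₀, ∀ k, T m k) : a ∈ FINL := by
  obtain ⟨c, hc, hcW⟩ := exists_computable_column_index a
  have hcW' : ∀ m j, Wset (c (Nat.pair m j)) = diagSet T m j := fun m j => by
    rw [hcW, hcol, Nat.unpair_pair]
  choose G N hGN hG using fun m => exists_finite_recogniser (h0 m) (hanti m)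
    fun j => ⟨c (Nat.pair m j), hcW' m j⟩
  have hg : Computable fun x : ℕ => if x.unpair.1 < m₀ then G x.unpair.1 x else none := by
    refine computable_of_eventually_none (N := (Finset.range m₀).sup N) fun x hx => ?_
    split_ifs with h
    · exact hGN _ _ (le_trans (Finset.le_sup (Finset.mem_range.2 h)) hx)
    · rfl
  let A : ℕ → Option ℕ := fun x =>
    bif decide (x.unpair.1 < m₀) then (if x.unpair.1 < m₀ then G x.unpair.1 x else none)
    else some (c (Nat.pair x.unpair.1 0))
  have hfst : Primrec fun x : ℕ => x.unpair.1 := Primrec.fst.comp Primrec.unpair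
  have hlt : Primrec fun x : ℕ => decide (x.unpair.1 < m₀) :=
    (Primrec.nat_lt.comp hfst (Primrec.const m₀)).decide
  have hA : Computable A :=
    Computable.cond hlt.to_comp hg (Computable.option_some.comp
      (hc.comp (Primrec₂.natPair.comp hfst (Primrec.const 0)).to_comp))
  refine mem_FINL_of_recognises hA fun i => ?_
  rw [hcol]
  generalize i.unpair.1 = m
  generalize i.unpair.2 = j
  by_cases hm : m < m₀
  · have hAG : ∀ x ∈ diagSet T m j, A x = G m x := fun x hx => by
      simp [A, hx.1, hm]
    obtain ⟨h1, x, hx, h2⟩ := hG m j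
    exact ⟨fun x hx h hAx => h1 x hx h (hAG x hx ▸ hAx), x, hx, hAG x hx ▸ h2⟩
  · have hAc : ∀ x ∈ diagSet T m j, A x = some (c (Nat.pair m 0)) := fun x hx => by
      simp [A, hx.1, hm]
    refine ⟨fun x hx h hAx => ?_, _, pair_zero_mem_diagSet (h0 m) j, ?_⟩
    · rw [hAc x hx] at hAx
      rw [← Option.some.inj hAx, hcW', diagSet_of_forall (hT m (not_lt.1 hm)),
        diagSet_of_forall (hT m (not_lt.1 hm))]
    · simp [hAc _ (pair_zero_mem_diagSet (h0 m) j)]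

/-- A learner that makes a conjecture on `σ` (an initial segment of `t`) cannot identify two sets
`S ≠ S'` both having texts that extend `σ`. -/
theorem not_learns_of_common_prefix {M : List ℕ →. Option ℕ} {t : ℕ → ℕ} {n v : ℕ}
    {S S' : Set ℕ} (hv : some v ∈ M (initSeg t n)) (hS : TxtFinLearnsSet M S)
    (hS' : TxtFinLearnsSet M S') (f f' : ℕ → ℕ) (hf : Set.range f = S) (hf' : Set.range f' = S')
    (hft : ∀ i < n, f i = t i) (hft' : ∀ i < n, f' i = t i) : S = S' := by
  obtain ⟨a, h, hlt, heq, hW⟩ := hS f hf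
  obtain ⟨a', h', hlt', heq', hW'⟩ := hS' f' hf'
  have hseg : ∀ b ≤ n, initSeg f b = initSeg t b := fun b hb =>
    initSeg_congr fun i hi => hft i (hi.trans_le hb)
  have hseg' : ∀ b ≤ n, initSeg f' b = initSeg t b := fun b hb =>
    initSeg_congr fun i hi => hft' i (hi.trans_le hb)
  have ha : a ≤ n := not_lt.1 fun hn => by
    have := hlt n hn
    rw [hseg n le_rfl] at this
    simp [this] at hv
  have ha' : a' ≤ n := not_lt.1 fun hn => by
    have := hlt' n hn
    rw [hseg' n le_rfl] at this
    simp [this] at hv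
  rw [hseg a ha] at heq
  rw [hseg' a' ha'] at heq'
  have haa : a = a' := by
    rcases lt_trichotomy a a' with hl | hl | hl
    · have := hlt' a hl
      rw [hseg' a ha, heq] at this
      simp at this
    · exact hl
    · have := hlt a' hl
      rw [hseg a' ha', heq'] at this
      simp at this
  subst haa
  have hh : h = h' := by
    rw [heq] at heq'
    simpa using heq'
  rw [← hf, ← hf', ← hW, ← hW', hh]

theorem notMem_FINL_of_forall_not {T : ℕ → ℕ → Prop} {a : ℕ}
    (hcol : ∀ i, column a i = diagSet T i.unpair.1 i.unpair.2) (h0 : ∀ m, T m 0)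
    (hanti : ∀ m k k', k ≤ k' → T m k' → T m k) (hT : ∀ m, ¬ ∀ k, T m k) : a ∉ FINL := by
  rintro ⟨M, hM, hlearn⟩
  obtain ⟨c, hc⟩ := Code.exists_code.1 hM
  obtain ⟨m, rfl⟩ : ∃ m, Denumerable.ofNat Code m = c :=
    ⟨Encodable.encode c, Denumerable.ofNat_encode c⟩
  have heval : ∀ σ v, v + 1 ∈ (Denumerable.ofNat Code m).eval (Encodable.encode σ) ↔
      some v ∈ M σ := fun σ v => by
    rw [hc]
    simp only [Encodable.encodek, Part.coe_some, Part.bind_some, Part.mem_map_iff]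
    constructor
    · rintro ⟨o, ho, hov⟩
      cases o with
      | none => simp at hov
      | some w => simpa [← Nat.succ.inj hov] using ho
    · exact fun h => ⟨_, h, rfl⟩
  obtain ⟨k, hk, hmax⟩ := exists_max_of_not_forall (h0 m) (hanti m) (hT m)
  have hmem := fun j y => mem_diagSet_of_max hk hmax (j := j) (y := y)
  have hl : ∀ j, TxtFinLearnsSet M (diagSet T m j) := fun j => by
    have := hlearn (Nat.pair m j)
    rwa [hcol, Nat.unpair_pair] at this
  have hconj : Conjectures m k := by
    by_contra hn
    obtain ⟨n, v, -, hv, -⟩ := hl 0 (blockText m k) (by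
      ext x
      constructor
      · rintro ⟨i, rfl⟩
        exact (hmem 0 _).2 (Or.inl (min_le_right _ _))
      · intro hx
        have hx1 : x.unpair.1 = m := hx.1
        rw [← Nat.pair_unpair x, hx1] at hx ⊢
        rw [hmem] at hx
        exact ⟨x.unpair.2, by simpa [blockText, hn] using hx⟩)
    exact hn ⟨n, v, (heval _ _).2 (by simp [hv])⟩
  obtain ⟨n, v, hv⟩ := id hconj
  let f : ℕ → ℕ → ℕ := fun j i => if i < n then blockText m k i else
    if i - n ≤ 3 * k then Nat.pair m (i - n) else Nat.pair m (3 * k + 1 + j % 2)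
  have hf : ∀ j, Set.range (f j) = diagSet T m j := fun j => by
    ext x
    constructor
    · rintro ⟨i, rfl⟩
      simp only [f]
      split_ifs with h1 h2
      · exact (hmem j _).2 (Or.inl (min_le_right _ _))
      · exact (hmem j _).2 (Or.inl h2)
      · exact (hmem j _).2 (Or.inr ⟨rfl, hconj⟩)
    · intro hx
      have hx1 : x.unpair.1 = m := hx.1
      rw [← Nat.pair_unpair x, hx1] at hx ⊢
      rw [hmem] at hx
      refine ⟨n + x.unpair.2, ?_⟩
      rcases hx with h | ⟨h, -⟩
      · simp [f, Nat.add_comm n, h]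
      · have : ¬ 3 * k + 1 + j % 2 ≤ 3 * k := by omega
        simp [f, Nat.add_comm n, h, this]
  have hft : ∀ j, ∀ i < n, f j i = blockText m k i := fun j i hi => if_pos hi
  have heq := not_learns_of_common_prefix ((heval _ _).1 hv) (hl 0) (hl 1) (f 0) (f 1)
    (hf 0) (hf 1) (hft 0) (hft 1)
  have h1 : Nat.pair m (3 * k + 1) ∈ diagSet T m 0 := (hmem 0 _).2 (Or.inr ⟨rfl, hconj⟩)
  rw [heq, hmem] at h1
  rcases h1 with h | ⟨h, -⟩ <;> omega

/-- The first `k` instances of some instance `x ≤ m` of a `∃∀∃` statement hold. -/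
def BoundedWitness (R : ℕ → ℕ → ℕ → Bool) (m k : ℕ) : Prop :=
  ∃ x ≤ m, ∀ y < k, ∃ z, R x y z = true

theorem exists_of_forall_boundedWitness {R : ℕ → ℕ → ℕ → Bool} {m : ℕ}
    (h : ∀ k, BoundedWitness R m k) : ∃ x, ∀ y, ∃ z, R x y z = true := by
  by_contra hn
  push Not at hn
  choose b hb using hn
  obtain ⟨x, hx, hy⟩ := h ((Finset.range (m + 1)).sup b + 1)
  obtain ⟨z, hz⟩ := hy (b x) (Nat.lt_succ_of_le
    (Finset.le_sup (f := b) (Finset.mem_range.2 (Nat.lt_succ_of_le hx))))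
  exact hb x z hz

/-- Decides whether the entries of `l` are witnesses for all `y < k`. -/
def checkWitnesses (R : ℕ → ℕ → Bool) (l : List ℕ) (k : ℕ) : Bool :=
  Nat.rec true (fun y b => b && R y (l.getD y 0)) k

theorem checkWitnesses_iff {R : ℕ → ℕ → Bool} {l : List ℕ} {k : ℕ} :
    checkWitnesses R l k = true ↔ ∀ y < k, R y (l.getD y 0) = true := by
  induction k with
  | zero => simp [checkWitnesses]
  | succ k ih =>
    have : checkWitnesses R l (k + 1) = (checkWitnesses R l k && R k (l.getD k 0)) := rfl
    rw [this, Bool.and_eq_true, ih, Nat.forall_lt_succ_right]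

theorem exists_checkWitnesses {R : ℕ → ℕ → Bool} {k : ℕ} :
    (∃ l, checkWitnesses R l k = true) ↔ ∀ y < k, ∃ z, R y z = true := by
  simp only [checkWitnesses_iff]
  constructor
  · rintro ⟨l, hl⟩ y hy
    exact ⟨_, hl y hy⟩
  · intro h
    choose! z hz using h
    exact ⟨(List.range k).map z, fun y hy => by simpa [hy] using hz y hy⟩

theorem computable_checkWitnesses {R : ℕ → ℕ → ℕ → ℕ → Bool}
    (hR : Computable (fun p : ℕ × ℕ × ℕ × ℕ => R p.1 p.2.1 p.2.2.1 p.2.2.2)) :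
    Computable fun q : ℕ × ℕ × List ℕ × ℕ => checkWitnesses (R q.1 q.2.1) q.2.2.1 q.2.2.2 := by
  have hq := Primrec.fst (α := ℕ × ℕ × List ℕ × ℕ) (β := ℕ × Bool)
  have hy := Primrec.fst.comp (Primrec.snd (α := ℕ × ℕ × List ℕ × ℕ) (β := ℕ × Bool))
  have hl := Primrec.fst.comp (Primrec.snd.comp (Primrec.snd.comp hq))
  have hargs := ((Primrec.fst.comp hq).pair ((Primrec.fst.comp (Primrec.snd.comp hq)).pair
    (hy.pair ((Primrec.list_getD 0).comp hl hy)))).to_comp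
  have hRargs := hR.comp hargs
  have hstep : Computable₂ fun (q : ℕ × ℕ × List ℕ × ℕ) (p : ℕ × Bool) =>
      p.2 && R q.1 q.2.1 p.1 (q.2.2.1.getD p.1 0) :=
    Primrec.and.to_comp.comp (Computable.snd.comp Computable.snd) hRargs
  have hk : Computable fun q : ℕ × ℕ × List ℕ × ℕ => q.2.2.2 :=
    Computable.snd.comp (Computable.snd.comp Computable.snd)
  exact (Computable.nat_rec hk (Computable.const true) hstep).of_eq fun _ => rfl

/-- Checks, for the witness `w = (k, x, l, s, n, v)`, that `p` lies in the diagonalising family. -/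
def checkDiag (R : ℕ → ℕ → ℕ → ℕ → Bool) (e p : ℕ) (w : ℕ × ℕ × List ℕ × ℕ × ℕ × ℕ) : Bool :=
  (decide (p.unpair.2.unpair.1 = p.unpair.1.unpair.1) &&
    (decide (w.2.1 ≤ p.unpair.1.unpair.1) && checkWitnesses (R e w.2.1) w.2.2.1 w.1)) &&
  (decide (p.unpair.2.unpair.2 ≤ 3 * w.1) ||
    (decide (p.unpair.2.unpair.2 = 3 * w.1 + 1 + p.unpair.1.unpair.2 % 2) &&
      decide (Code.evaln w.2.2.2.1 (Denumerable.ofNat Code p.unpair.1.unpair.1)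
        (Encodable.encode (initSeg (blockText p.unpair.1.unpair.1 w.1) w.2.2.2.2.1)) =
          some (w.2.2.2.2.2 + 1))))

theorem computable_checkDiag {R : ℕ → ℕ → ℕ → ℕ → Bool}
    (hR : Computable (fun p : ℕ × ℕ × ℕ × ℕ => R p.1 p.2.1 p.2.2.1 p.2.2.2)) :
    Computable fun q : ℕ × ℕ × ℕ × ℕ × List ℕ × ℕ × ℕ × ℕ => checkDiag R q.1 q.2.1 q.2.2 := by
  have hp : Primrec fun q : ℕ × ℕ × ℕ × ℕ × List ℕ × ℕ × ℕ × ℕ => q.2.1.unpair :=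
    Primrec.unpair.comp (Primrec.fst.comp Primrec.snd)
  have hi := Primrec.unpair.comp (Primrec.fst.comp hp)
  have hx := Primrec.unpair.comp (Primrec.snd.comp hp)
  have hm := Primrec.fst.comp hi
  have hy := Primrec.snd.comp hx
  have hw : Primrec fun q : ℕ × ℕ × ℕ × ℕ × List ℕ × ℕ × ℕ × ℕ => q.2.2 :=
    Primrec.snd.comp Primrec.snd
  have hk := Primrec.fst.comp hw
  have hw1 := Primrec.snd.comp hw
  have hw2 := Primrec.snd.comp hw1
  have hw3 := Primrec.snd.comp hw2
  have hw4 := Primrec.snd.comp hw3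
  have h3k := Primrec.nat_mul.comp (Primrec.const 3) hk
  have hcheck := (computable_checkWitnesses hR).comp (Primrec.fst.pair
    ((Primrec.fst.comp hw1).pair ((Primrec.fst.comp hw2).pair hk))).to_comp
  have hseg : Primrec fun q : ℕ × ℕ × ℕ × ℕ × List ℕ × ℕ × ℕ × ℕ =>
      initSeg (blockText q.2.1.unpair.1.unpair.1 q.2.2.1) q.2.2.2.2.2.2.1 := by
    refine Primrec.list_map (Primrec.list_range.comp (Primrec.fst.comp hw4)) ?_
    exact Primrec₂.natPair.comp (hm.comp Primrec.fst)
      (Primrec.nat_min.comp Primrec.snd (h3k.comp Primrec.fst))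
  have hevaln := Code.primrec_evaln.comp (((Primrec.fst.comp hw3).pair
    ((Primrec.ofNat Code).comp hm)).pair (Primrec.encode.comp hseg))
  have hmod := Primrec.nat_mod.comp (Primrec.snd.comp hi) (Primrec.const 2)
  have hrhs := Primrec.nat_add.comp (Primrec.nat_add.comp h3k (Primrec.const 1)) hmod
  have hval := Primrec.option_some.comp (Primrec.succ.comp (Primrec.snd.comp hw4))
  exact Primrec.and.to_comp.comp
    (Primrec.and.to_comp.comp (Primrec.eq.comp (Primrec.fst.comp hx) hm).decide.to_comp
      (Primrec.and.to_comp.comp (Primrec.nat_le.comp (Primrec.fst.comp hw1) hm).decide.to_comp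
        hcheck))
    (Primrec.or.comp (Primrec.nat_le.comp hy h3k).decide
      (Primrec.and.comp (Primrec.eq.comp hy hrhs).decide
        (Primrec.eq.comp hevaln hval).decide)).to_comp

theorem exists_checkDiag_iff {R : ℕ → ℕ → ℕ → ℕ → Bool} {e i x : ℕ} :
    (∃ w, checkDiag R e (Nat.pair i x) w = true) ↔
      x ∈ diagSet (BoundedWitness (R e)) i.unpair.1 i.unpair.2 := by
  simp only [checkDiag, Bool.and_eq_true, Bool.or_eq_true, decide_eq_true_eq, Nat.unpair_pair,
    diagSet, Set.mem_ofPred_eq, Conjectures, BoundedWitness, ← exists_checkWitnesses]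
  constructor
  · rintro ⟨⟨k, x', l, s, n, v⟩, ⟨h1, h2, h3⟩, h4⟩
    exact ⟨h1, k, ⟨x', h2, l, h3⟩, h4.imp_right fun h => ⟨h.1, n, v, Code.evaln_sound h.2⟩⟩
  · rintro ⟨h1, k, ⟨x', h2, l, h3⟩, h4 | ⟨h4, n, v, h5⟩⟩
    · exact ⟨⟨k, x', l, 0, 0, 0⟩, ⟨h1, h2, h3⟩, Or.inl h4⟩
    · obtain ⟨s, hs⟩ := Code.evaln_complete.1 h5
      exact ⟨⟨k, x', l, s, n, v⟩, ⟨h1, h2, h3⟩, Or.inr ⟨h4, hs⟩⟩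

/-- FINL is Σ⁰₃-hard. -/
theorem FINL_sigma3_hard :
    ∀ P : Set ℕ, IsSigma3 P →
      ∃ g : ℕ → ℕ, Computable g ∧ ∀ e, e ∈ P ↔ g e ∈ FINL := by
  rintro P ⟨R, hR, hP⟩
  obtain ⟨g, hg, hgW⟩ := exists_computable_index (checkDiag R) (computable_checkDiag hR)
  refine ⟨g, hg, fun e => ?_⟩
  have hcol : ∀ i, column (g e) i =
      diagSet (BoundedWitness (R e)) i.unpair.1 i.unpair.2 := fun i =>
    Set.ext fun x => (hgW e _).trans exists_checkDiag_iff
  have h0 : ∀ m, BoundedWitness (R e) m 0 := fun m => ⟨0, Nat.zero_le m, by simp⟩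
  have hanti : ∀ m k k', k ≤ k' → BoundedWitness (R e) m k' → BoundedWitness (R e) m k :=
    fun m k k' hkk' ⟨x, hx, h⟩ => ⟨x, hx, fun y hy => h y (hy.trans_le hkk')⟩
  rw [hP]
  constructor
  · rintro ⟨x, hx⟩
    exact mem_FINL_of_eventually_forall hcol h0 hanti (m₀ := x)
      fun m hm k => ⟨x, hm, fun y _ => hx y⟩
  · intro h
    by_contra hn
    exact notMem_FINL_of_forall_not hcol h0 hanti
      (fun m hm => hn (exists_of_forall_boundedWitness hm)) h
end

section
/- Let G be a u.c.e. family of c.e. sets. Either G is TxtBC-learnable by some computable learner, or for every computable learner M there is a Δ⁰₂ enumeration of some member of G that M fails to TxtBC-identify. Equivalently: if some computable learner TxtBC-identifies every Δ⁰₂ enumeration of every member of G, then G is TxtBC-learnable (from arbitrary enumerations). -/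
open Filter Encodable Denumerable

/-- Primitive recursive predicates are closed under existential quantification below a primitive
recursive bound. -/
theorem PrimrecRel.exists_lt_bound {α : Type*} [Primcodable α] {R : α → ℕ → Prop} {n : α → ℕ}
    (hR : PrimrecRel R) (hn : Primrec n) : PrimrecPred fun a => ∃ x < n a, R a x :=
  ((PrimrecRel.exists_mem_list (R := fun x a => R a x) (hR.comp Primrec.snd Primrec.fst)).comp
    (Primrec.list_range.comp hn) Primrec.id).of_eq (by simp)

/-- Primitive recursive predicates are closed under universal quantification below a primitive
recursive bound. -/
theorem PrimrecRel.forall_lt_bound {α : Type*} [Primcodable α] {R : α → ℕ → Prop} {n : α → ℕ}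
    (hR : PrimrecRel R) (hn : Primrec n) : PrimrecPred fun a => ∀ x < n a, R a x :=
  ((PrimrecRel.forall_mem_list (R := fun x a => R a x) (hR.comp Primrec.snd Primrec.fst)).comp
    (Primrec.list_range.comp hn) Primrec.id).of_eq (by simp)

theorem primrecRel_list_subset : PrimrecRel fun σ τ : List ℕ => σ ⊆ τ := by
  have h : PrimrecRel fun (x : ℕ) (τ : List ℕ) => x ∈ τ :=
    ((PrimrecRel.exists_mem_list (R := fun b a : ℕ => b = a) Primrec.eq).comp
      Primrec.snd Primrec.fst).of_eq fun p => by simp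
  exact (PrimrecRel.forall_mem_list h).of_eq fun σ τ => Iff.rfl

/-- The domain of a partial computable function has a primitive recursive stagewise enumeration. -/
theorem Partrec.exists_primrec_stages {α : Type*} [Primcodable α] {p : α →. ℕ} (hp : Partrec p) :
    ∃ v : ℕ → α → Bool, Primrec₂ v ∧ (∀ s a, v s a = true → (p a).Dom) ∧
      ∀ a, (p a).Dom → ∀ᶠ s in atTop, v s a = true := by
  obtain ⟨c, hc⟩ := Nat.Partrec.Code.exists_code.1 hp
  have hdom : ∀ a, (Nat.Partrec.Code.eval c (encode a)).Dom ↔ (p a).Dom := fun a => by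
    rw [hc]; simp
  refine ⟨fun s a => (Nat.Partrec.Code.evaln s c (encode a)).isSome, ?_, fun s a h => ?_,
    fun a h => ?_⟩
  · exact Primrec.option_isSome.comp (Nat.Partrec.Code.primrec_evaln.comp
      ((Primrec.fst.pair (Primrec.const c)).pair (Primrec.encode.comp Primrec.snd)))
  · obtain ⟨x, hx⟩ := Option.isSome_iff_exists.1 h
    exact (hdom a).1 (Part.dom_iff_mem.2 ⟨x, Nat.Partrec.Code.evaln_sound hx⟩)
  · obtain ⟨x, hx⟩ := Part.dom_iff_mem.1 ((hdom a).2 h)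
    obtain ⟨k, hk⟩ := Nat.Partrec.Code.evaln_complete.1 hx
    filter_upwards [eventually_ge_atTop k] with s hs
    exact Option.isSome_iff_exists.2 ⟨x, Nat.Partrec.Code.evaln_mono hs hk⟩

/-- Uniformly c.e. sets given by a stagewise enumeration have computable indices. -/
theorem exists_computable_index_s4 {α : Type*} [Primcodable α] {R : ℕ → α × ℕ → Prop}
    (hR : PrimrecRel R) :
    ∃ h : α → ℕ, Computable h ∧ ∀ a y, y ∈ Wset (h a) ↔ ∃ s, R s (a, y) := by
  classical
  have hp : Partrec fun q : α × ℕ => Nat.rfind fun s => Part.some (decide (R s q)) :=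
    Partrec.rfind (hR.comp Primrec.snd Primrec.fst).decide.to_comp.partrec
  obtain ⟨c, hc⟩ := Nat.Partrec.Code.exists_code.1 hp
  refine ⟨fun a => encode (Nat.Partrec.Code.curry c (encode a)),
    (Primrec.encode.comp (Nat.Partrec.Code.primrec₂_curry.comp (Primrec.const c)
      Primrec.encode)).to_comp, fun a y => ?_⟩
  simp only [Wset, Nat.Partrec.Code.eval_curry, hc, Set.mem_ofPred_eq, ofNat_encode]
  rw [show Nat.pair (encode a) y = encode (a, y) from rfl]
  simp only [encodek, Part.coe_some, Part.bind_some]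
  refine Nat.rfind_dom.trans ⟨fun ⟨s, hs, _⟩ => ⟨s, ?_⟩, fun ⟨s, hs⟩ => ⟨s, ?_, fun _ => trivial⟩⟩
  · simpa using hs
  · simpa using hs

/-- The hypothesis of `M` on `τ` is defined and its set contains `y`. -/
def HypMem (M : List ℕ →. ℕ) (τ : List ℕ) (y : ℕ) : Prop :=
  ∃ h, h ∈ M τ ∧ y ∈ Wset h

/-- The hypothesis of `M` on `τ` is defined and is an index of `S`. -/
def HypCorrect (M : List ℕ →. ℕ) (τ : List ℕ) (S : Set ℕ) : Prop :=
  ∃ h, M τ = Part.some h ∧ Wset h = S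

theorem HypCorrect.hypMem_iff {M : List ℕ →. ℕ} {τ : List ℕ} {S : Set ℕ}
    (h : HypCorrect M τ S) (y : ℕ) : HypMem M τ y ↔ y ∈ S := by
  obtain ⟨e, he, rfl⟩ := h
  simp [HypMem, he]

theorem hypCorrect_of_hypMem_iff {M : List ℕ →. ℕ} {τ : List ℕ} {S : Set ℕ} (hS : S.Nonempty)
    (h : ∀ y, HypMem M τ y ↔ y ∈ S) : HypCorrect M τ S := by
  obtain ⟨y, hy⟩ := hS
  obtain ⟨e, he, -⟩ := (h y).2 hy
  refine ⟨e, Part.eq_some_iff.2 he, Set.ext fun z => Iff.trans ?_ (h z)⟩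
  exact ⟨fun hz => ⟨e, he, hz⟩, fun ⟨e', he', hz⟩ => Part.mem_unique he' he ▸ hz⟩

theorem exists_hypMem_stages {M : List ℕ →. ℕ} (hM : Partrec M) :
    ∃ v : ℕ → List ℕ × ℕ → Bool, Primrec₂ v ∧ (∀ s τ y, v s (τ, y) = true → HypMem M τ y) ∧
      ∀ τ y, HypMem M τ y → ∀ᶠ s in atTop, v s (τ, y) = true := by
  have hp : Partrec fun q : List ℕ × ℕ => (M q.1).bind fun h =>
      (ofNat Nat.Partrec.Code h).eval q.2 :=
    (hM.comp Computable.fst).bind (Nat.Partrec.Code.eval_part.comp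
      ((Computable.ofNat _).comp Computable.snd) (Computable.snd.comp Computable.fst))
  have hdom : ∀ τ y, ((M τ).bind fun h => (ofNat Nat.Partrec.Code h).eval y).Dom ↔
      HypMem M τ y := fun τ y => by
    simp only [Part.dom_iff_mem, Part.mem_bind_iff, HypMem, Wset, Set.mem_ofPred_eq]
    exact ⟨fun ⟨x, h, h₁, h₂⟩ => ⟨h, h₁, x, h₂⟩, fun ⟨h, h₁, x, h₂⟩ => ⟨x, h, h₁, h₂⟩⟩
  obtain ⟨v, hv, h₁, h₂⟩ := hp.exists_primrec_stages
  exact ⟨v, hv, fun s τ y h => (hdom τ y).1 (h₁ s (τ, y) h),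
    fun τ y h => h₂ (τ, y) ((hdom τ y).2 h)⟩

/-- `y` is enumerated on input `τ` on behalf of some sequence `m`, all of whose considered
extensions produce `y`, while every sequence before `m` has a considered extension producing `y`.
Sequences are given by their codes and considered when their code is below the length of `τ` and
their content is contained in that of `τ`. -/
def Supported (P : List ℕ → ℕ → Prop) (τ : List ℕ) (y : ℕ) : Prop :=
  ∃ m < τ.length, ofNat (List ℕ) m ⊆ τ ∧
    (∀ r < τ.length, ofNat (List ℕ) r ⊆ τ → P (ofNat (List ℕ) m ++ ofNat (List ℕ) r) y) ∧
    ∀ k < m, ofNat (List ℕ) k ⊆ τ →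
      ∃ r < τ.length, ofNat (List ℕ) r ⊆ τ ∧ P (ofNat (List ℕ) k ++ ofNat (List ℕ) r) y

theorem Supported.mono {P Q : List ℕ → ℕ → Prop} (h : ∀ σ y, P σ y → Q σ y) {τ : List ℕ} {y : ℕ} :
    Supported P τ y → Supported Q τ y :=
  fun ⟨m, hm, hmτ, h₁, h₂⟩ => ⟨m, hm, hmτ, fun r hr hrτ => h _ _ (h₁ r hr hrτ), fun k hk hkτ =>
    let ⟨r, hr, hrτ, hP⟩ := h₂ k hk hkτ; ⟨r, hr, hrτ, h _ _ hP⟩⟩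

theorem Supported.eventually {v : ℕ → List ℕ → ℕ → Prop} {P : List ℕ → ℕ → Prop}
    (h : ∀ σ y, P σ y → ∀ᶠ s in atTop, v s σ y) {τ : List ℕ} {y : ℕ} (hP : Supported P τ y) :
    ∀ᶠ s in atTop, Supported (v s) τ y := by
  obtain ⟨m, hm, hmτ, h₁, h₂⟩ := hP
  have e₁ : ∀ᶠ s in atTop, ∀ r ∈ {r | r < τ.length}, ofNat (List ℕ) r ⊆ τ →
      v s (ofNat (List ℕ) m ++ ofNat (List ℕ) r) y := by
    rw [(Set.finite_lt_nat _).eventually_all]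
    intro r hr
    by_cases hrτ : ofNat (List ℕ) r ⊆ τ
    · exact (h _ _ (h₁ r hr hrτ)).mono fun s hs _ => hs
    · exact Eventually.of_forall fun s hs => absurd hs hrτ
  have e₂ : ∀ᶠ s in atTop, ∀ k ∈ {k | k < m}, ofNat (List ℕ) k ⊆ τ →
      ∃ r < τ.length, ofNat (List ℕ) r ⊆ τ ∧
        v s (ofNat (List ℕ) k ++ ofNat (List ℕ) r) y := by
    rw [(Set.finite_lt_nat _).eventually_all]
    intro k hk
    by_cases hkτ : ofNat (List ℕ) k ⊆ τ
    · obtain ⟨r, hr, hrτ, hP⟩ := h₂ k hk hkτ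
      exact (h _ _ hP).mono fun s hs _ => ⟨r, hr, hrτ, hs⟩
    · exact Eventually.of_forall fun s hs => absurd hs hkτ
  filter_upwards [e₁, e₂] with s hs₁ hs₂
  exact ⟨m, hm, hmτ, hs₁, hs₂⟩

theorem primrecRel_supported {v : ℕ → List ℕ × ℕ → Bool} (hv : Primrec₂ v) :
    PrimrecRel fun s (q : List ℕ × ℕ) =>
      Supported (fun σ y => v s (σ, y) = true) q.1 q.2 := by
  have seq : Primrec (ofNat (List ℕ)) := Primrec.ofNat _
  have hV : ∀ {α : Type} [Primcodable α] {s : α → ℕ} {σ ρ y : α → ℕ}, Primrec s → Primrec σ →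
      Primrec ρ → Primrec y → PrimrecPred fun a =>
        v (s a) (ofNat (List ℕ) (σ a) ++ ofNat (List ℕ) (ρ a), y a) = true :=
    fun hs hσ hρ hy => Primrec.eq.comp (hv.comp hs
      ((Primrec.list_append.comp (seq.comp hσ) (seq.comp hρ)).pair hy)) (Primrec.const true)
  have hsub : ∀ {α : Type} [Primcodable α] {σ : α → ℕ} {τ : α → List ℕ}, Primrec σ → Primrec τ →
      PrimrecPred fun a => ofNat (List ℕ) (σ a) ⊆ τ a :=
    fun hσ hτ => primrecRel_list_subset.comp (seq.comp hσ) hτ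
  have imp : ∀ {α : Type} [Primcodable α] {p q : α → Prop}, PrimrecPred p → PrimrecPred q →
      PrimrecPred fun a => p a → q a := fun hp hq =>
    (hp.not.or hq).of_eq fun a => imp_iff_not_or.symm
  have len : ∀ {α : Type} [Primcodable α] {τ : α → List ℕ}, Primrec τ →
      Primrec fun a => (τ a).length := fun hτ => Primrec.list_length.comp hτ
  open Primrec in
  refine PrimrecRel.exists_lt_bound (α := ℕ × List ℕ × ℕ) ?_ (len (fst.comp snd))
  refine PrimrecPred.and (hsub snd (fst.comp (snd.comp fst))) (PrimrecPred.and ?_ ?_)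
  · refine PrimrecRel.forall_lt_bound (α := (ℕ × List ℕ × ℕ) × ℕ) ?_
      (len (fst.comp (snd.comp fst)))
    exact imp (hsub snd (fst.comp (snd.comp (fst.comp fst))))
      (hV (fst.comp (fst.comp fst)) (snd.comp fst) snd (snd.comp (snd.comp (fst.comp fst))))
  · refine PrimrecRel.forall_lt_bound (α := (ℕ × List ℕ × ℕ) × ℕ) ?_ snd
    refine imp (hsub snd (fst.comp (snd.comp (fst.comp fst)))) ?_
    refine PrimrecRel.exists_lt_bound (α := ((ℕ × List ℕ × ℕ) × ℕ) × ℕ) ?_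
      (len (fst.comp (snd.comp (fst.comp fst))))
    exact (hsub snd (fst.comp (snd.comp (fst.comp (fst.comp fst))))).and
      (hV (fst.comp (fst.comp (fst.comp fst))) (snd.comp fst) snd
        (snd.comp (snd.comp (fst.comp (fst.comp fst)))))

theorem subset_initSeg_eventually {f : ℕ → ℕ} {σ : List ℕ} (h : ∀ x ∈ σ, x ∈ Set.range f) :
    ∀ᶠ n in atTop, σ ⊆ initSeg f n := by
  have : ∀ᶠ n in atTop, ∀ x ∈ {x | x ∈ σ}, x ∈ initSeg f n := by
    rw [(List.finite_toSet σ).eventually_all]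
    intro x hx
    obtain ⟨j, rfl⟩ := h x hx
    filter_upwards [eventually_gt_atTop j] with n hn
    exact List.mem_map.2 ⟨j, List.mem_range.2 hn, rfl⟩
  exact this

/-- If locking sequences for `range f` are dense, then on almost all initial segments of `f`
exactly the members of `range f` are supported. -/
theorem supported_hypMem_eventually {M : List ℕ →. ℕ} {f : ℕ → ℕ}
    (hd : ∀ σ : List ℕ, (∀ x ∈ σ, x ∈ Set.range f) → ∃ ρ : List ℕ, (∀ x ∈ ρ, x ∈ Set.range f) ∧
      ∀ ρ' : List ℕ, (∀ x ∈ ρ', x ∈ Set.range f) → HypCorrect M (σ ++ ρ ++ ρ') (Set.range f)) :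
    ∀ᶠ n in atTop, ∀ y, Supported (HypMem M) (initSeg f n) y ↔ y ∈ Set.range f := by
  obtain ⟨σ₀, hσ₀, hlock⟩ := hd [] (by simp)
  simp only [List.nil_append] at hlock
  have hσ' : ofNat (List ℕ) (encode σ₀) = σ₀ := ofNat_encode _
  have hcorr : ∀ k, (∀ x ∈ ofNat (List ℕ) k, x ∈ Set.range f) → ∀ᶠ n in atTop, ∃ r < n,
      ofNat (List ℕ) r ⊆ initSeg f n ∧
      HypCorrect M (ofNat (List ℕ) k ++ ofNat (List ℕ) r) (Set.range f) := by
    intro k hk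
    obtain ⟨ρ, hρ, hc⟩ := hd _ hk
    filter_upwards [subset_initSeg_eventually hρ, eventually_gt_atTop (encode ρ)] with n hn hn'
    exact ⟨encode ρ, hn', by simpa using hn, by simpa using hc [] (by simp)⟩
  have hall : ∀ᶠ n in atTop, ∀ k ∈ {k | k ≤ encode σ₀},
      (∀ x ∈ ofNat (List ℕ) k, x ∈ Set.range f) → ∃ r < n, ofNat (List ℕ) r ⊆ initSeg f n ∧
        HypCorrect M (ofNat (List ℕ) k ++ ofNat (List ℕ) r) (Set.range f) := by
    rw [(Set.finite_le_nat _).eventually_all]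
    intro k _
    by_cases hk : ∀ x ∈ ofNat (List ℕ) k, x ∈ Set.range f
    · exact (hcorr k hk).mono fun n hn _ => hn
    · exact Eventually.of_forall fun n hn => absurd hn hk
  filter_upwards [hall, subset_initSeg_eventually hσ₀, eventually_gt_atTop (encode σ₀)]
    with n hn hσn hlt y
  have hlen : (initSeg f n).length = n := by simp [initSeg]
  have hin : ∀ {σ : List ℕ}, σ ⊆ initSeg f n → ∀ x ∈ σ, x ∈ Set.range f := fun hσ x hx => by
    obtain ⟨j, -, rfl⟩ := List.mem_map.1 (hσ hx)
    exact ⟨j, rfl⟩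
  simp only [Supported, hlen]
  constructor
  · rintro ⟨m, -, hmτ, h₁, h₂⟩
    rcases le_or_gt m (encode σ₀) with hm | hm
    · obtain ⟨r, hr, hrτ, hc⟩ := hn m hm (hin hmτ)
      exact (hc.hypMem_iff y).1 (h₁ r hr hrτ)
    · obtain ⟨r, -, hrτ, hP⟩ := h₂ _ hm (by rwa [hσ'])
      rw [hσ'] at hP
      exact ((hlock _ (hin hrτ)).hypMem_iff y).1 hP
  · intro hy
    refine ⟨encode σ₀, hlt, by rwa [hσ'], fun r _ hrτ => ?_, fun k hk hkτ => ?_⟩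
    · rw [hσ']
      exact ((hlock _ (hin hrτ)).hypMem_iff y).2 hy
    · obtain ⟨r, hr, hrτ, hc⟩ := hn k (le_of_lt hk) (hin hkτ)
      exact ⟨r, hr, hrτ, (hc.hypMem_iff y).2 hy⟩

/-- A single learner identifies every enumeration of every set for which the locking sequences of
`M` are dense. -/
theorem exists_learner_of_dense_locking {M : List ℕ →. ℕ} (hM : Partrec M) :
    ∃ N : List ℕ →. ℕ, Partrec N ∧ ∀ f : ℕ → ℕ,
      (∀ σ : List ℕ, (∀ x ∈ σ, x ∈ Set.range f) → ∃ ρ : List ℕ, (∀ x ∈ ρ, x ∈ Set.range f) ∧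
        ∀ ρ' : List ℕ, (∀ x ∈ ρ', x ∈ Set.range f) →
          HypCorrect M (σ ++ ρ ++ ρ') (Set.range f)) → TxtBCIdentifies N f := by
  obtain ⟨v, hv, hv₁, hv₂⟩ := exists_hypMem_stages hM
  obtain ⟨h, hh, hW⟩ := exists_computable_index_s4 (primrecRel_supported hv)
  refine ⟨fun τ => Part.some (h τ), hh.partrec, fun f hd => ?_⟩
  obtain ⟨n₀, hn₀⟩ := eventually_atTop.1 (supported_hypMem_eventually hd)
  refine ⟨n₀, fun n hn => ⟨_, rfl, Set.ext fun y => (hW _ y).trans ?_⟩⟩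
  rw [← hn₀ n hn y]
  exact ⟨fun ⟨s, hs⟩ => hs.mono fun σ y => hv₁ s σ y, fun hs => (hs.eventually hv₂).exists⟩

/-- A nonempty c.e. set is the range of a primitive recursive function. -/
theorem exists_primrec_range_eq {S : Set ℕ} (hS : S.Nonempty) {w : ℕ → ℕ → Bool}
    (hw : Primrec₂ w) (hwS : ∀ s y, w s y = true → y ∈ S)
    (hSw : ∀ y ∈ S, ∀ᶠ s in atTop, w s y = true) :
    ∃ e : ℕ → ℕ, Primrec e ∧ Set.range e = S := by
  obtain ⟨x₀, hx₀⟩ := hS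
  refine ⟨fun n => bif w n.unpair.1 n.unpair.2 then n.unpair.2 else x₀, ?_, Set.ext fun y => ?_⟩
  · have h₁ := Primrec.fst.comp Primrec.unpair
    have h₂ := Primrec.snd.comp Primrec.unpair
    exact Primrec.cond (hw.comp h₁ h₂) h₂ (Primrec.const x₀)
  · constructor
    · rintro ⟨n, rfl⟩
      cases h : w n.unpair.1 n.unpair.2
      · simpa [h] using hx₀
      · simpa [h] using hwS _ _ h
    · intro hy
      obtain ⟨s, hs⟩ := (hSw y hy).exists
      exact ⟨Nat.pair s y, by simp [hs]⟩

/-- The least witness of a predicate is approximated by searching through stages that converge to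
the predicate. -/
theorem findIdx_range_eventually_eq {d : ℕ → ℕ → Bool} {D : ℕ → Prop} [DecidablePred D]
    (hd : ∀ c, ∀ᶠ s in atTop, (d s c = true ↔ D c)) (hD : ∃ c, D c) :
    ∀ᶠ s in atTop, (List.range s).findIdx (d s) = Nat.find hD := by
  have : ∀ᶠ s in atTop, ∀ c ∈ {c | c ≤ Nat.find hD}, (d s c = true ↔ D c) := by
    rw [(Set.finite_le_nat _).eventually_all]
    exact fun c _ => hd c
  filter_upwards [this, eventually_gt_atTop (Nat.find hD)] with s hs hlt
  rw [List.findIdx_eq (by simpa using hlt)]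
  simp only [List.getElem_range]
  refine ⟨(hs _ le_rfl).2 (Nat.find_spec hD), fun j hj => ?_⟩
  rw [Bool.eq_false_iff, ne_eq, hs j hj.le]
  exact Nat.find_min hD hj

/-- The chain of sequences obtained by repeatedly appending the sequence chosen by `p` followed by
the next natural number. -/
def chain (p : List ℕ → ℕ) (k : ℕ) : List ℕ :=
  k.rec [] fun k l => l ++ (ofNat (List ℕ × ℕ) (p l)).1 ++ [k]

theorem chain_succ (p : List ℕ → ℕ) (k : ℕ) :
    chain p (k + 1) = chain p k ++ (ofNat (List ℕ × ℕ) (p (chain p k))).1 ++ [k] := rfl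

theorem primrec_chain {p : ℕ → List ℕ → ℕ} (hp : Primrec₂ p) :
    Primrec₂ fun s k => chain (p s) k := by
  refine Primrec.nat_rec (f := fun _ => []) (g := fun s a =>
    a.2 ++ (ofNat (List ℕ × ℕ) (p s a.2)).1 ++ [a.1]) (Primrec.const []) ?_
  have hl : Primrec fun a : ℕ × ℕ × List ℕ => a.2.2 := Primrec.snd.comp Primrec.snd
  refine Primrec.list_append.comp (Primrec.list_append.comp hl (Primrec.fst.comp
    ((Primrec.ofNat _).comp (hp.comp Primrec.fst hl)))) ?_
  have hk : Primrec fun a : ℕ × ℕ × List ℕ => a.2.1 := Primrec.fst.comp Primrec.snd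
  exact Primrec.list_cons.comp hk (Primrec.const [])

theorem chain_eventually_eq {p : ℕ → List ℕ → ℕ} {q : List ℕ → ℕ}
    (h : ∀ l, ∀ᶠ s in atTop, p s l = q l) (k : ℕ) :
    ∀ᶠ s in atTop, chain (p s) k = chain q k := by
  induction k with
  | zero => exact Eventually.of_forall fun s => rfl
  | succ k ih =>
    filter_upwards [ih, h (chain q k)] with s hs hs'
    rw [chain_succ, chain_succ, hs, hs']

theorem le_length_chain (p : List ℕ → ℕ) (k : ℕ) : k ≤ (chain p k).length := by
  induction k with
  | zero => exact Nat.zero_le _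
  | succ k ih => simp only [chain_succ, List.length_append, List.length_singleton]; omega

theorem chain_prefix_chain (p : List ℕ → ℕ) {j k : ℕ} (h : j ≤ k) : chain p j <+: chain p k := by
  induction k, h using Nat.le_induction with
  | base => exact List.prefix_refl _
  | succ k _ ih =>
    rw [chain_succ, List.append_assoc]
    exact ih.trans (List.prefix_append _ _)

/-- The infinite sequence extending `l₀` that is determined by `chain p`. -/
def chainLimit (l₀ : List ℕ) (p : List ℕ → ℕ) (x : ℕ) : ℕ :=
  (l₀ ++ chain p (x + 1)).getD x 0

theorem initSeg_chainLimit {l₀ t : List ℕ} {p : List ℕ → ℕ} {k : ℕ}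
    (ht : t <+: l₀ ++ chain p k) : initSeg (chainLimit l₀ p) t.length = t := by
  refine List.ext_getElem (by simp [initSeg]) fun x _ hx => ?_
  have hlen : x < (l₀ ++ chain p (x + 1)).length := by
    have := le_length_chain p (x + 1)
    simp only [List.length_append]
    omega
  have h₁ : t <+: l₀ ++ chain p (max k (x + 1)) :=
    ht.trans ((List.prefix_append_right_inj l₀).2 (chain_prefix_chain p (le_max_left _ _)))
  have h₂ : l₀ ++ chain p (x + 1) <+: l₀ ++ chain p (max k (x + 1)) :=
    (List.prefix_append_right_inj l₀).2 (chain_prefix_chain p (le_max_right _ _))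
  simp only [initSeg, List.getElem_map, List.getElem_range, chainLimit,
    List.getD_eq_getElem _ _ hlen]
  rw [h₁.getElem hx, h₂.getElem hlen]

theorem initSeg_comp (e g : ℕ → ℕ) (n : ℕ) : initSeg (e ∘ g) n = (initSeg g n).map e := by
  simp [initSeg]

theorem mem_range_chainLimit (l₀ : List ℕ) (p : List ℕ → ℕ) (k : ℕ) :
    k ∈ Set.range (chainLimit l₀ p) := by
  have h : k ∈ l₀ ++ chain p (k + 1) := by simp [chain_succ]
  rw [← initSeg_chainLimit (List.prefix_refl (l₀ ++ chain p (k + 1)))] at h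
  obtain ⟨j, -, hj⟩ := List.mem_map.1 h
  exact ⟨j, hj⟩

theorem isDelta2Fun_comp_chainLimit {e : ℕ → ℕ} (he : Primrec e) (l₀ : List ℕ)
    {p : ℕ → List ℕ → ℕ} (hp : Primrec₂ p) {q : List ℕ → ℕ}
    (h : ∀ l, ∀ᶠ s in atTop, p s l = q l) : IsDelta2Fun (e ∘ chainLimit l₀ q) := by
  refine ⟨fun s x => e (chainLimit l₀ (p s) x), ?_, fun x => ?_⟩
  · have : Primrec₂ fun s x => chainLimit l₀ (p s) x :=
      (Primrec.list_getD 0).comp (Primrec.list_append.comp (Primrec.const l₀)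
        ((primrec_chain hp).comp Primrec.fst (Primrec.succ.comp Primrec.snd))) Primrec.snd
    exact (he.comp this).to_comp
  · obtain ⟨s₀, hs₀⟩ := eventually_atTop.1 (chain_eventually_eq h (x + 1))
    exact ⟨s₀, fun s hs => by simp [chainLimit, hs₀ s hs]⟩

/-- If `M` identifies every `Δ⁰₂` enumeration of a nonempty c.e. set `S`, then the locking sequences
of `M` for `S` are dense. -/
theorem dense_locking_of_delta2 {M : List ℕ →. ℕ} (hM : Partrec M) {S : Set ℕ} (hS : S.Nonempty)
    {p : ℕ →. ℕ} (hp : Partrec p) (hpS : ∀ y, (p y).Dom ↔ y ∈ S)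
    (hlearn : ∀ f, IsDelta2Fun f → Set.range f = S → TxtBCIdentifies M f)
    (σ : List ℕ) (hσ : ∀ x ∈ σ, x ∈ S) :
    ∃ ρ : List ℕ, (∀ x ∈ ρ, x ∈ S) ∧
      ∀ ρ' : List ℕ, (∀ x ∈ ρ', x ∈ S) → HypCorrect M (σ ++ ρ ++ ρ') S := by
  classical
  obtain ⟨w, hw, hw₁, hw₂⟩ := hp.exists_primrec_stages
  simp only [hpS] at hw₁ hw₂
  obtain ⟨e, he, rfl⟩ := exists_primrec_range_eq hS hw hw₁ hw₂
  obtain ⟨v, hv, hv₁, hv₂⟩ := exists_hypMem_stages hM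
  have lift : ∀ τ : List ℕ, (∀ x ∈ τ, x ∈ Set.range e) → ∃ l : List ℕ, l.map e = τ := by
    intro τ hτ
    have : τ ∈ Set.range (List.map e) := by rw [Set.range_list_map]; exact hτ
    exact this
  obtain ⟨l₀, rfl⟩ := lift σ hσ
  by_contra! hbad
  let seq : List ℕ → ℕ → List ℕ := fun l c => (l₀ ++ l ++ (ofNat (List ℕ × ℕ) c).1).map e
  let pt : ℕ → ℕ := fun c => (ofNat (List ℕ × ℕ) c).2
  let D : List ℕ → ℕ → Prop := fun l c => ¬(HypMem M (seq l c) (pt c) ↔ pt c ∈ Set.range e)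
  let d : ℕ → List ℕ → ℕ → Bool := fun s l c => xor (v s (seq l c, pt c)) (w s (pt c))
  have hD : ∀ l, ∃ c, D l c := by
    intro l
    obtain ⟨ρ', hρ', hc⟩ := hbad (l.map e) (by simp)
    obtain ⟨r, rfl⟩ := lift ρ' hρ'
    by_contra! h
    refine hc (hypCorrect_of_hypMem_iff hS fun y => ?_)
    have := h (encode (r, y))
    simpa [D, seq, pt] using this
  have stage : ∀ {P : Prop} {b : ℕ → Bool}, (∀ s, b s = true → P) →
      (P → ∀ᶠ s in atTop, b s = true) → ∀ᶠ s in atTop, (b s = true ↔ P) := by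
    intro P b h₁ h₂
    by_cases hP : P
    · exact (h₂ hP).mono fun s hs => iff_of_true hs hP
    · exact Eventually.of_forall fun s => iff_of_false (fun hs => hP (h₁ s hs)) hP
  have hd : ∀ l c, ∀ᶠ s in atTop, (d s l c = true ↔ D l c) := by
    intro l c
    filter_upwards [stage (fun s => hv₁ s (seq l c) (pt c)) (hv₂ (seq l c) (pt c)),
      stage (fun s => hw₁ s (pt c)) (hw₂ (pt c))] with s h₁ h₂
    simp only [D, d, ← h₁, ← h₂]
    cases v s (seq l c, pt c) <;> cases w s (pt c) <;> simp
  let q : List ℕ → ℕ := fun l => Nat.find (hD l)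
  have hprim : Primrec₂ fun s l => (List.range s).findIdx (d s l) := by
    refine Primrec.list_findIdx (Primrec.list_range.comp Primrec.fst) ?_
    have hc : Primrec fun a : (ℕ × List ℕ) × ℕ => ofNat (List ℕ × ℕ) a.2 :=
      (Primrec.ofNat _).comp Primrec.snd
    have hs : Primrec fun a : (ℕ × List ℕ) × ℕ => a.1.1 := Primrec.fst.comp Primrec.fst
    have hseq : Primrec fun a : (ℕ × List ℕ) × ℕ => seq a.1.2 a.2 :=
      Primrec.list_map (Primrec.list_append.comp (Primrec.list_append.comp (Primrec.const l₀)
        (Primrec.snd.comp Primrec.fst)) (Primrec.fst.comp hc)) (he.comp Primrec.snd)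
    exact (Primrec.dom_bool₂ xor).comp (hv.comp hs (hseq.pair (Primrec.snd.comp hc)))
      (hw.comp hs (Primrec.snd.comp hc))
  have hrange : Set.range (e ∘ chainLimit l₀ q) = Set.range e := by
    refine (Set.range_comp_subset_range _ _).antisymm ?_
    rintro _ ⟨k, rfl⟩
    obtain ⟨j, hj⟩ := mem_range_chainLimit l₀ q k
    exact ⟨j, by simp [hj]⟩
  obtain ⟨n, hn⟩ := hlearn _ (isDelta2Fun_comp_chainLimit he l₀ hprim (q := q)
    fun l => findIdx_range_eventually_eq (hd l) (hD l)) hrange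
  have hpre : l₀ ++ chain q n ++ (ofNat (List ℕ × ℕ) (q (chain q n))).1 <+:
      l₀ ++ chain q (n + 1) := by
    rw [chain_succ, ← List.append_assoc, ← List.append_assoc]
    exact List.prefix_append _ _
  have hlen := le_length_chain q n
  have hcorrect := hn _ (show (l₀ ++ chain q n ++ (ofNat (List ℕ × ℕ) (q (chain q n))).1).length ≥ n
    by simp only [List.length_append]; omega)
  rw [initSeg_comp, initSeg_chainLimit hpre, hrange] at hcorrect
  exact Nat.find_spec (hD (chain q n)) (HypCorrect.hypMem_iff hcorrect _)

/-- Either the u.c.e. family of columns of `W_a` is TxtBC-learnable, or for each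
computable learner `M` there is a Δ⁰₂ enumeration of a member of the family
that `M` fails to TxtBC-identify. -/
theorem txtBC_delta2_enumeration_suffices (a : ℕ) :
    (∃ M : List ℕ →. ℕ, Partrec M ∧ ∀ i, TxtBCLearnsSet M (column a i)) ∨
    (∀ M : List ℕ →. ℕ, Partrec M →
      ∃ f : ℕ → ℕ, IsDelta2Fun f ∧ (∃ i, Set.range f = column a i) ∧
        ¬ TxtBCIdentifies M f) := by
  by_cases H : ∃ M : List ℕ →. ℕ, Partrec M ∧ ∀ f : ℕ → ℕ, IsDelta2Fun f →
      (∃ i, Set.range f = column a i) → TxtBCIdentifies M f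
  · left
    obtain ⟨M, hM, hlearn⟩ := H
    obtain ⟨N, hN, hNf⟩ := exists_learner_of_dense_locking hM
    refine ⟨N, hN, fun i f hf => hNf f ?_⟩
    have hp : Partrec fun y => (Denumerable.ofNat Nat.Partrec.Code a).eval (Nat.pair i y) :=
      Nat.Partrec.Code.eval_part.comp (Computable.const _)
        (Primrec₂.natPair.comp (Primrec.const i) Primrec.id).to_comp
    exact dense_locking_of_delta2 hM (Set.range_nonempty f) hp (fun y => by rw [hf]; rfl)
      fun g hg hgf => hlearn g hg ⟨i, hgf.trans hf⟩
  · right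
    intro M hM
    by_contra! h
    exact H ⟨M, hM, fun f hf hi => h f hf hi⟩
end
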